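/- There is no positive integer $N$ such that $\omega(2N) = \omega(2N+1)$, $\omega(2N+1) = \omega(2N+2)$, and $\omega(N) = \omega(N+1)$ all hold simultaneously. (Consequently, in any set of positive integers $a_1, \ldots, a_5$ satisfying $\gcd(a_i,a_j) = |a_i - a_j|$ and $\omega(a_i/|a_i-a_j|) = \omega(a_j/|a_i-a_j|)$ for all pairs, no three elements can be consecutive integers.) -/

import Mathlib

theorem Nat.card_primeFactors_mul_of_prime_of_dvd {p n : ℕ} (hp : p.Prime) (hn : n ≠ 0)
    (h : p ∣ n) : (p * n).primeFactors.card = n.primeFactors.card := by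
  rw [Nat.primeFactors_mul hp.ne_zero hn, hp.primeFactors, Finset.union_eq_right.mpr]
  simp [hp, h, hn]

theorem Nat.card_primeFactors_mul_of_prime_of_not_dvd {p n : ℕ} (hp : p.Prime)
    (h : ¬ p ∣ n) : (p * n).primeFactors.card = n.primeFactors.card + 1 := by
  have hc : p.Coprime n := hp.coprime_iff_not_dvd.mpr h
  rw [hc.primeFactors_mul, Finset.card_union_of_disjoint hc.disjoint_primeFactors,
    hp.primeFactors, Finset.card_singleton, add_comm]

/-- There is no positive integer `N` such that `ω(2N) = ω(2N+1)`, `ω(2N+1) = ω(2N+2)`,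
and `ω(N) = ω(N+1)` all hold simultaneously. -/
theorem no_triple_omega_eq :
    ¬ ∃ N : ℕ, 0 < N ∧
      (2 * N).primeFactors.card = (2 * N + 1).primeFactors.card ∧
      (2 * N + 1).primeFactors.card = (2 * N + 2).primeFactors.card ∧
      N.primeFactors.card = (N + 1).primeFactors.card := by
  rintro ⟨N, hN, h₁, h₂, h₃⟩
  rw [show 2 * N + 2 = 2 * (N + 1) by ring] at h₂
  by_cases h : 2 ∣ N
  · have h₄ := Nat.card_primeFactors_mul_of_prime_of_dvd Nat.prime_two hN.ne' h
    have h₅ := Nat.card_primeFactors_mul_of_prime_of_not_dvd Nat.prime_two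
      (show ¬ 2 ∣ N + 1 by omega)
    omega
  · have h₄ := Nat.card_primeFactors_mul_of_prime_of_not_dvd Nat.prime_two h
    have h₅ := Nat.card_primeFactors_mul_of_prime_of_dvd Nat.prime_two N.succ_ne_zero
      (show 2 ∣ N + 1 by omega)
    simp only [Nat.succ_eq_add_one] at h₅
    omega
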